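/- Let d ≥ 1, m ≥ 2d+3, 1 < v < m, and let F ⊆ [m]∖{v} be a 2d-subset. Then F is a lower facet of the vertex figure C(m,2d+1)∖v if and only if F∪{y} is a facet of C([m]_{v+}, 2d+1); dually, F is an upper facet of C(m,2d+1)∖v if and only if F∪{x} is a facet of C([m]_{v+}, 2d+1). -/

import Mathlib

open scoped Classical

namespace HST

/-- `AltChain l₁ l₂` holds when the alternating merge of the two lists, starting with the
head of `l₁`, is strictly increasing: `a₀ < b₀ < a₁ < b₁ < ⋯`.  The lengths must satisfy
`l₂.length ≤ l₁.length ≤ l₂.length + 1`. -/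
def AltChain : List ℚ → List ℚ → Prop
  | [], [] => True
  | [], _ :: _ => False
  | [_], [] => True
  | _ :: _ :: _, [] => False
  | a :: as, b :: bs => a < b ∧ AltChain (b :: bs) as
termination_by l₁ l₂ => l₁.length + l₂.length
decreasing_by simp; omega

/-- The alternating merge starting with the least element of `A`. -/
def Intertwines (A B : Finset ℚ) : Prop :=
  AltChain (A.sort (· ≤ ·)) (B.sort (· ≤ ·))

/-- The paper's intertwining relation `A ≀ B`: for `#A = #B = k + 1` it means
`a₀ < b₀ < a₁ < b₁ < ⋯ < a_k < b_k`; for `#A = #B - 1` it means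
`b₀ < a₀ < b₁ < a₁ < ⋯ < b_k`. -/
def Wr (A B : Finset ℚ) : Prop :=
  if A.card = B.card then Intertwines A B else Intertwines B A

/-- Gale's evenness criterion: upper facets of the cyclic polytope with vertex set `V`. -/
def IsUpperFacet (V : Finset ℚ) (n : ℕ) (F : Finset ℚ) : Prop :=
  F ⊆ V ∧ F.card = n ∧ ∀ w ∈ V \ F, Odd ((F.filter fun x => w < x).card)

/-- Gale's evenness criterion: lower facets of the cyclic polytope with vertex set `V`. -/
def IsLowerFacet (V : Finset ℚ) (n : ℕ) (F : Finset ℚ) : Prop :=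
  F ⊆ V ∧ F.card = n ∧ ∀ w ∈ V \ F, Even ((F.filter fun x => w < x).card)

def IsFacet (V : Finset ℚ) (n : ℕ) (F : Finset ℚ) : Prop :=
  IsUpperFacet V n F ∨ IsLowerFacet V n F

/-- The circuits of the cyclic polytope `C(V, n)`. -/
def IsCircuit (V : Finset ℚ) (n : ℕ) (Zp Zm : Finset ℚ) : Prop :=
  Zp ⊆ V ∧ Zm ⊆ V ∧
    ((Zp.card = n / 2 + 1 ∧ Zm.card = (n + 1) / 2 + 1 ∧ Wr Zp Zm) ∨
      (Zm.card = n / 2 + 1 ∧ Zp.card = (n + 1) / 2 + 1 ∧ Wr Zm Zp))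

/-- Combinatorial triangulations of the cyclic polytope `C(V, n)`. -/
def IsTriangulation (V : Finset ℚ) (n : ℕ) (T : Finset (Finset ℚ)) : Prop :=
  (∀ S ∈ T, S ⊆ V ∧ S.card = n + 1) ∧
    (∀ S ∈ T, ∀ F ⊆ S, F.card = n →
      (∃ G, IsFacet V n G ∧ F ⊆ G) ∨ ∃ R ∈ T, R ≠ S ∧ F ⊆ R) ∧
    (∀ S ∈ T, ∀ R ∈ T, ∀ Zp Zm, IsCircuit V n Zp Zm → ¬(Zp ⊆ S ∧ Zm ⊆ R))

noncomputable def lowerFacets (V : Finset ℚ) (n : ℕ) : Finset (Finset ℚ) :=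
  V.powerset.filter fun F => IsLowerFacet V n F

noncomputable def upperFacets (V : Finset ℚ) (n : ℕ) : Finset (Finset ℚ) :=
  V.powerset.filter fun F => IsUpperFacet V n F

/-- `T'` is an increasing bistellar flip of `T`. -/
def IsIncFlip (V : Finset ℚ) (n : ℕ) (T T' : Finset (Finset ℚ)) : Prop :=
  ∃ U, U ⊆ V ∧ U.card = n + 2 ∧ lowerFacets U (n + 1) ⊆ T ∧
    T' = (T \ lowerFacets U (n + 1)) ∪ upperFacets U (n + 1)

/-- The first higher Stasheff–Tamari order. -/
def Le1 (V : Finset ℚ) (n : ℕ) : Finset (Finset ℚ) → Finset (Finset ℚ) → Prop :=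
  Relation.ReflTransGen (IsIncFlip V n)

/-- `simp(T)`: the internal `⌊n/2⌋`-simplices of a triangulation `T` of `C(V, n)`. -/
noncomputable def internalSimps (V : Finset ℚ) (n : ℕ) (T : Finset (Finset ℚ)) :
    Finset (Finset ℚ) :=
  V.powerset.filter fun A =>
    A.card = n / 2 + 1 ∧ (∃ S ∈ T, A ⊆ S) ∧ ∀ F, IsFacet V n F → ¬A ⊆ F

/-- The second higher Stasheff–Tamari order in even dimension `n = 2d`. -/
def Le2Even (V : Finset ℚ) (d : ℕ) (T T' : Finset (Finset ℚ)) : Prop :=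
  ∀ A ∈ internalSimps V (2 * d) T, ∀ B ∈ internalSimps V (2 * d) T', ¬Wr B A

/-- The second higher Stasheff–Tamari order in odd dimension `n = 2d + 1`. -/
def Le2Odd (V : Finset ℚ) (d : ℕ) (T T' : Finset (Finset ℚ)) : Prop :=
  internalSimps V (2 * d + 1) T' ⊆ internalSimps V (2 * d + 1) T

/-- The second higher Stasheff–Tamari order. -/
def Le2 (V : Finset ℚ) (n : ℕ) (T T' : Finset (Finset ℚ)) : Prop :=
  if Even n then ∀ A ∈ internalSimps V n T, ∀ B ∈ internalSimps V n T', ¬Wr B A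
  else internalSimps V n T' ⊆ internalSimps V n T

/-- The vertex set `[m] = {1, …, m}`, realised inside `ℚ`. -/
noncomputable def vSet (m : ℕ) : Finset ℚ := (Finset.Icc 1 m).image fun i => (i : ℚ)

/-- `C(U, n)` is a subpolytope of the triangulation `T`. -/
def IsSubpolytope (n : ℕ) (T : Finset (Finset ℚ)) (U : Finset ℚ) : Prop :=
  IsTriangulation U n (T.filter fun S => S ⊆ U)

/-- Contraction of a triangulation along a vertex map `c`. -/
noncomputable def contractTri (c : ℚ → ℚ) (n : ℕ) (T : Finset (Finset ℚ)) :
    Finset (Finset ℚ) :=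
  (T.image fun S => S.image c).filter fun S => S.card = n + 1

/-- The vertex map of the contraction `[m - 1 ← m]`. -/
def topMap (m : ℚ) (a : ℚ) : ℚ := if a = m then m - 1 else a

/-- The vertex map of the contraction `[1 → 2]`. -/
def botMap (a : ℚ) : ℚ := if a = 1 then 2 else a

/-- The vertex `x` of `[N]_{v+}`, realised in `ℚ`. -/
def xOf (v : ℕ) : ℚ := (v : ℚ) - 1/3

/-- The vertex `y` of `[N]_{v+}`, realised in `ℚ`. -/
def yOf (v : ℕ) : ℚ := (v : ℚ) + 1/3

/-- The vertex set `[N]_{v+} = {1, …, v - 1, x, y, v + 1, …, N}`. -/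
noncomputable def vPlus (N v : ℕ) : Finset ℚ :=
  insert (xOf v) (insert (yOf v) ((vSet N).erase (v : ℚ)))

/-- The vertex map of the contraction `[x → v ← y]`. -/
def midMap (v : ℕ) (a : ℚ) : ℚ := if a = xOf v ∨ a = yOf v then (v : ℚ) else a

/-- `U_{v+}` for a subset `U` of `[N]`. -/
noncomputable def setVPlus (v : ℕ) (U : Finset ℚ) : Finset ℚ :=
  if (v : ℚ) ∈ U then insert (xOf v) (insert (yOf v) (U.erase (v : ℚ))) else U

/-- `I(m, d)`: the internal `d`-simplices of `C(m, 2d)`. -/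
noncomputable def Iset (m d : ℕ) : Finset (Finset ℚ) :=
  (vSet m).powerset.filter fun A =>
    A.card = d + 1 ∧ (∀ a ∈ A, a + 1 ∉ A) ∧ ¬((1 : ℚ) ∈ A ∧ (m : ℚ) ∈ A)

/-- `O(m, d)`: the internal `d`-simplices of `C(m, 2d + 1)`. -/
noncomputable def Oset (m d : ℕ) : Finset (Finset ℚ) :=
  (Iset m d).filter fun A => (1 : ℚ) ∉ A ∧ (m : ℚ) ∉ A


/-- `G` decomposes as a disjoint union of pairs of consecutive numbers, with pair-starts
`P`, together with the endpoint `e ∈ {1, m}`. -/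
def PairDecomp (m : ℕ) (G P : Finset ℚ) (e : ℚ) : Prop :=
  (e = 1 ∨ e = (m : ℚ)) ∧ (∀ p ∈ P, p + 1 ∉ P) ∧
    e ∉ P ∧ e ∉ P.image (fun p => p + 1) ∧
    G = insert e (P ∪ P.image fun p => p + 1)

/-- `F` is a lower facet of the vertex figure `C(m, n) ∖ v`: `F ∪ {v}` is a facet of
`C(m, n)` in which `v` is paired with `v + 1`. -/
def VFLowerFacet (m : ℕ) (v : ℚ) (n : ℕ) (F : Finset ℚ) : Prop :=
  v ∉ F ∧ IsFacet (vSet m) n (insert v F) ∧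
    ∃ P e, PairDecomp m (insert v F) P e ∧ v ∈ P

/-- `F` is an upper facet of the vertex figure `C(m, n) ∖ v`: `F ∪ {v}` is a facet of
`C(m, n)` in which `v` is paired with `v - 1`. -/
def VFUpperFacet (m : ℕ) (v : ℚ) (n : ℕ) (F : Finset ℚ) : Prop :=
  v ∉ F ∧ IsFacet (vSet m) n (insert v F) ∧
    ∃ P e, PairDecomp m (insert v F) P e ∧ v - 1 ∈ P

/-- The number of elements of `F` above `w`. -/
noncomputable def above (F : Finset ℚ) (w : ℚ) : ℕ := (F.filter fun x => w < x).card

/-- Gale's evenness criterion with the parity recorded by a proposition: upper facets for a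
true `u`, lower facets for a false `u`. -/
def Gale (u : Prop) (V : Finset ℚ) (n : ℕ) (F : Finset ℚ) : Prop :=
  F ⊆ V ∧ F.card = n ∧ ∀ w ∈ V \ F, (Odd (above F w) ↔ u)

theorem isFacet_iff_exists_gale {V : Finset ℚ} {n : ℕ} {F : Finset ℚ} :
    IsFacet V n F ↔ ∃ u, Gale u V n F := by
  constructor
  · rintro (⟨h1, h2, h3⟩ | ⟨h1, h2, h3⟩)
    · exact ⟨True, h1, h2, fun w hw => iff_true_intro (h3 w hw)⟩
    · exact ⟨False, h1, h2, fun w hw => iff_false_intro (Nat.not_odd_iff_even.2 (h3 w hw))⟩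
  · rintro ⟨u, h1, h2, h3⟩
    by_cases hu : u
    · exact Or.inl ⟨h1, h2, fun w hw => (h3 w hw).2 hu⟩
    · exact Or.inr ⟨h1, h2, fun w hw => Nat.not_odd_iff_even.1 fun h => hu ((h3 w hw).1 h)⟩

theorem mem_vSet {m : ℕ} {a : ℚ} : a ∈ vSet m ↔ ∃ i : ℕ, 1 ≤ i ∧ i ≤ m ∧ (i : ℚ) = a := by
  simp [vSet, and_assoc]

theorem natCast_mem_vSet {m i : ℕ} : (i : ℚ) ∈ vSet m ↔ 1 ≤ i ∧ i ≤ m := by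
  rw [mem_vSet]
  constructor
  · rintro ⟨j, h1, h2, h⟩
    obtain rfl : j = i := by exact_mod_cast h
    exact ⟨h1, h2⟩
  · rintro ⟨h1, h2⟩
    exact ⟨i, h1, h2, rfl⟩

theorem above_insert {F : Finset ℚ} {z : ℚ} (hz : z ∉ F) (w : ℚ) :
    above (insert z F) w = above F w + if w < z then 1 else 0 := by
  unfold above
  rw [Finset.filter_insert]
  split_ifs
  · rw [Finset.card_insert_of_notMem (by simp [hz])]
  · rfl

theorem above_congr {F : Finset ℚ} {w w' : ℚ} (h : ∀ x ∈ F, (w < x ↔ w' < x)) :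
    above F w = above F w' := by
  unfold above
  rw [Finset.filter_congr h]

theorem above_natCast {m : ℕ} {G : Finset ℚ} (hG : G ⊆ vSet m) (i : ℕ) :
    above G i = above G ((i + 1 : ℕ) : ℚ) + if ((i + 1 : ℕ) : ℚ) ∈ G then 1 else 0 := by
  have key : ∀ x ∈ G, ((i : ℚ) < x ↔ x = ((i + 1 : ℕ) : ℚ) ∨ ((i + 1 : ℕ) : ℚ) < x) := by
    intro x hx
    obtain ⟨j, -, -, rfl⟩ := mem_vSet.1 (hG hx)
    simp only [Nat.cast_lt, Nat.cast_inj]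
    omega
  unfold above
  rw [Finset.filter_congr key, Finset.filter_or, Finset.card_union_of_disjoint, add_comm,
    Finset.filter_eq']
  · split_ifs <;> simp
  · rw [Finset.disjoint_filter]
    rintro x - rfl
    exact lt_irrefl _

theorem above_top {m : ℕ} {G : Finset ℚ} (hG : G ⊆ vSet m) : above G m = 0 := by
  unfold above
  rw [Finset.card_eq_zero, Finset.filter_eq_empty_iff]
  intro x hx
  obtain ⟨j, -, hj, rfl⟩ := mem_vSet.1 (hG hx)
  simpa using hj

theorem above_zero {m : ℕ} {G : Finset ℚ} (hG : G ⊆ vSet m) : above G (0 : ℕ) = G.card := by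
  unfold above
  rw [Finset.filter_true_of_mem]
  intro x hx
  obtain ⟨j, hj, -, rfl⟩ := mem_vSet.1 (hG hx)
  exact_mod_cast hj

theorem PairDecomp.mem_iff {m : ℕ} {G P : Finset ℚ} {e : ℚ} (h : PairDecomp m G P e) (i : ℕ) :
    ((i + 1 : ℕ) : ℚ) ∈ G ↔
      e = ((i + 1 : ℕ) : ℚ) ∨ ((i + 1 : ℕ) : ℚ) ∈ P ∨ (i : ℚ) ∈ P := by
  rw [h.2.2.2.2]
  simp [eq_comm]

/-- In a pair decomposition, the parity of the number of elements above a vertex is determined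
by whether the vertex starts a pair and whether the endpoint lies above it. -/
theorem PairDecomp.odd_above {m : ℕ} {G P : Finset ℚ} {e : ℚ} (h : PairDecomp m G P e)
    (hG : G ⊆ vSet m) {i : ℕ} (hi : i ≤ m) :
    Odd (above G i) ↔ ¬((i : ℚ) ∈ P ↔ (i : ℚ) < e) := by
  induction hi using Nat.decreasingInduction with
  | self =>
    have hP : (m : ℚ) ∉ P := fun hm => by
      have := natCast_mem_vSet.1 (hG ((h.mem_iff m).2 (Or.inr (Or.inr hm))))
      omega
    have he : ¬(m : ℚ) < e := by
      have : e ∈ vSet m := hG (h.2.2.2.2 ▸ Finset.mem_insert_self _ _)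
      obtain ⟨j, -, hj, rfl⟩ := mem_vSet.1 this
      simpa using hj
    simp [above_top hG, hP, he]
  | of_succ i hi ih =>
    have hmem := h.mem_iff i
    obtain ⟨-, hP, heP, heP', -⟩ := id h
    have h1 : (i : ℚ) ∈ P → ((i + 1 : ℕ) : ℚ) ∉ P := fun hp => by simpa using hP _ hp
    have h2 : (i : ℚ) ∈ P → e ≠ ((i + 1 : ℕ) : ℚ) := fun hp he =>
      heP' (Finset.mem_image.2 ⟨i, hp, by simp [he]⟩)
    have h3 : e = ((i + 1 : ℕ) : ℚ) → ((i + 1 : ℕ) : ℚ) ∉ P := fun he => he ▸ heP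
    have h4 : (i : ℚ) < e ↔ e = ((i + 1 : ℕ) : ℚ) ∨ ((i + 1 : ℕ) : ℚ) < e := by
      have : e ∈ vSet m := hG (h.2.2.2.2 ▸ Finset.mem_insert_self _ _)
      obtain ⟨j, -, -, rfl⟩ := mem_vSet.1 this
      simp only [Nat.cast_lt, Nat.cast_inj]
      omega
    have h5 : e = ((i + 1 : ℕ) : ℚ) → ¬((i + 1 : ℕ) : ℚ) < e := fun he => by simp [he]
    rw [above_natCast hG i]
    by_cases hg : ((i + 1 : ℕ) : ℚ) ∈ G
    · rw [if_pos hg, Nat.odd_add_one, ih]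
      grind only
    · rw [if_neg hg, add_zero, ih]
      grind only

theorem exists_mem_vSet_sdiff {m n : ℕ} {G : Finset ℚ} (hG : G.card = n) (hn : n < m) :
    ∃ i : ℕ, 1 ≤ i ∧ i ≤ m ∧ (i : ℚ) ∉ G := by
  have hc : (vSet m).card = m := by
    have : vSet m = (Finset.Icc 1 m).image fun i : ℕ => (i : ℚ) := by
      ext a
      simp [mem_vSet, and_assoc]
    rw [this, Finset.card_image_of_injective _ Nat.cast_injective, Nat.card_Icc]
    omega
  obtain ⟨x, hx, hxG⟩ := Finset.exists_mem_notMem_of_card_lt_card (by omega : G.card < (vSet m).card)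
  obtain ⟨i, h1, h2, rfl⟩ := mem_vSet.1 hx
  exact ⟨i, h1, h2, hxG⟩

/-- The endpoint in a pair decomposition of a facet is `m` for upper facets and `1` for lower
facets. -/
theorem PairDecomp.natCast_lt_iff {m n : ℕ} {u : Prop} {G P : Finset ℚ} {e : ℚ}
    (h : PairDecomp m G P e) (hg : Gale u (vSet m) n G) (hn : n < m) {v : ℕ} (hv1 : 1 < v)
    (hvm : v < m) : (v : ℚ) < e ↔ u := by
  obtain ⟨hG, hcard, hgap⟩ := hg
  obtain ⟨w, hw1, hwm, hw⟩ := exists_mem_vSet_sdiff hcard hn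
  have hu := hgap w (Finset.mem_sdiff.2 ⟨natCast_mem_vSet.2 ⟨hw1, hwm⟩, hw⟩)
  rw [h.odd_above hG hwm] at hu
  obtain ⟨he, -, -, -, hGe⟩ := id h
  have heG : e ∈ G := hGe ▸ Finset.mem_insert_self _ _
  have hwP : (w : ℚ) ∉ P := fun hp => hw (by rw [hGe]; simp [hp])
  have hwe : (w : ℚ) ≠ e := fun h => hw (h ▸ heG)
  have : (w : ℚ) < e ↔ (v : ℚ) < e := by
    rcases he with rfl | rfl
    · norm_cast
      omega
    · norm_cast at hwe ⊢
      omega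
  tauto

/-- A facet of an odd-dimensional cyclic polytope has a pair decomposition. -/
theorem Gale.exists_pairDecomp {m d : ℕ} {u : Prop} {G : Finset ℚ}
    (hg : Gale u (vSet m) (2 * d + 1) G) (hn : 2 * d + 1 < m) :
    ∃ P e, PairDecomp m G P e := by
  obtain ⟨hG, hcard, hgap⟩ := hg
  have hgap' : ∀ i : ℕ, 1 ≤ i → i ≤ m → (i : ℚ) ∉ G → (Odd (above G i) ↔ u) :=
    fun i h1 h2 h3 => hgap i (Finset.mem_sdiff.2 ⟨natCast_mem_vSet.2 ⟨h1, h2⟩, h3⟩)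
  have hstep := above_natCast hG
  have htop := above_top hG
  have hzero : Odd (above G (0 : ℕ)) := by rw [above_zero hG, hcard]; exact odd_two_mul_add_one d
  have hno : ¬Odd 0 := by decide
  obtain ⟨e, he1, hem, heG, heu, hel⟩ : ∃ e : ℕ, 1 ≤ e ∧ e ≤ m ∧ (e : ℚ) ∈ G ∧ (u → e = m) ∧
      (¬u → e = 1) := by
    by_cases hu : u
    · refine ⟨m, by omega, le_rfl, ?_, fun _ => rfl, fun h => absurd hu h⟩
      by_contra h
      have := (hgap' m (by omega) le_rfl h).2 hu
      rw [htop] at this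
      exact hno this
    · refine ⟨1, le_rfl, by omega, ?_, fun h => absurd h hu, fun _ => rfl⟩
      by_contra h
      refine hu ((hgap' 1 le_rfl (by omega) h).1 ?_)
      have h0 := hstep 0
      rw [zero_add, if_neg h, add_zero] at h0
      exact h0 ▸ hzero
  have hsucc : ∀ i : ℕ, Odd (above G i) ↔
      ¬(Odd (above G ((i + 1 : ℕ) : ℚ)) ↔ ((i + 1 : ℕ) : ℚ) ∈ G) := by
    intro i
    rw [hstep i]
    split_ifs with h
    · rw [Nat.odd_add_one]; grind only
    · rw [add_zero]; grind only
  obtain ⟨P, hPdef⟩ : ∃ P, P = G.filter fun p => p ≠ (e : ℚ) ∧ (Odd (above G p) ↔ ¬u) :=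
    ⟨_, rfl⟩
  have hPG : P ⊆ G := hPdef ▸ Finset.filter_subset _ _
  have hPmem : ∀ i : ℕ, (i : ℚ) ∈ P ↔ (i : ℚ) ∈ G ∧ i ≠ e ∧ (Odd (above G i) ↔ ¬u) := by
    intro i
    rw [hPdef, Finset.mem_filter, Ne, Nat.cast_inj]
  have hPlt : ∀ i : ℕ, (i : ℚ) ∈ P → 1 ≤ i ∧ i < m := by
    intro i hi
    obtain ⟨h1, h2, h3⟩ := (hPmem i).1 hi
    have hv := natCast_mem_vSet.1 (hG h1)
    refine ⟨hv.1, lt_of_le_of_ne hv.2 ?_⟩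
    rintro rfl
    rw [htop] at h3
    by_cases hu : u
    · exact h2 (heu hu).symm
    · exact hno (h3.2 hu)
  have hPsucc : ∀ i : ℕ, (i : ℚ) ∈ P →
      ((i + 1 : ℕ) : ℚ) ∈ G ∧ (Odd (above G ((i + 1 : ℕ) : ℚ)) ↔ u) := by
    intro i hi
    have hlt := hPlt i hi
    obtain ⟨h1, h2, h3⟩ := (hPmem i).1 hi
    have h4 := hsucc i
    by_cases h5 : ((i + 1 : ℕ) : ℚ) ∈ G
    · exact ⟨h5, by grind only⟩
    · have := hgap' (i + 1) (by omega) (by omega) h5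
      grind only
  have hPnat : ∀ p ∈ P, ∃ i : ℕ, (i : ℚ) = p := fun p hp => by
    obtain ⟨i, -, -, h⟩ := mem_vSet.1 (hG (hPG hp))
    exact ⟨i, h⟩
  refine ⟨P, e, ?_, ?_, ?_, ?_, ?_⟩
  · by_cases hu : u
    · exact Or.inr (by rw [heu hu])
    · exact Or.inl (by rw [hel hu]; simp)
  · intro p hp hp'
    obtain ⟨i, rfl⟩ := hPnat p hp
    have h1 := (hPsucc i hp).2
    have h2 := ((hPmem (i + 1)).1 (by push_cast; exact hp')).2.2
    grind only
  · simp [hPdef]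
  · intro h
    obtain ⟨p, hp, hpe⟩ := Finset.mem_image.1 h
    obtain ⟨i, rfl⟩ := hPnat p hp
    have hie : i + 1 = e := by exact_mod_cast hpe
    have hlt := hPlt i hp
    have h1 := (hPsucc i hp).2
    by_cases hu : u
    · rw [hie, heu hu, htop] at h1
      exact hno (h1.2 hu)
    · have := hel hu
      omega
  · ext g
    simp only [Finset.mem_insert, Finset.mem_union, Finset.mem_image]
    constructor
    · intro hgG
      obtain ⟨j, hj1, hjm, rfl⟩ := mem_vSet.1 (hG hgG)
      obtain ⟨i, rfl⟩ : ∃ i, j = i + 1 := ⟨j - 1, by omega⟩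
      by_cases hje : i + 1 = e
      · exact Or.inl (by rw [hje])
      by_cases hjP : ((i + 1 : ℕ) : ℚ) ∈ P
      · exact Or.inr (Or.inl hjP)
      refine Or.inr (Or.inr ⟨i, ?_, by push_cast; rfl⟩)
      have h1 := hsucc i
      have h2 : Odd (above G ((i + 1 : ℕ) : ℚ)) ↔ u := by
        have := hPmem (i + 1)
        grind only
      have h3 : Odd (above G i) ↔ ¬u := by grind only
      rcases Nat.eq_zero_or_pos i with rfl | hi
      · exact absurd (hel (h3.1 hzero)).symm (by simpa using hje)
      refine (hPmem i).2 ⟨?_, ?_, h3⟩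
      · by_contra h4
        have := hgap' i hi (by omega) h4
        grind only
      · rintro rfl
        by_cases hu : u
        · have := heu hu
          omega
        · have hi1 := hel hu
          subst hi1
          have h0 := hsucc 0
          rw [zero_add] at h0
          grind only
    · rintro (rfl | hp | ⟨p, hp, rfl⟩)
      · exact heG
      · exact hPG hp
      · obtain ⟨i, rfl⟩ := hPnat p hp
        simpa using (hPsucc i hp).1

/-- In a facet, the pair containing `v` starts at `v` or at `v - 1`, according to the parity of
the number of elements above `v`. -/
theorem PairDecomp.mem_start_iff {m n : ℕ} {u : Prop} {G P : Finset ℚ} {e : ℚ}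
    (h : PairDecomp m G P e) (hg : Gale u (vSet m) n G) (hn : n < m) {v : ℕ} (hv1 : 1 < v)
    (hvm : v < m) (hv : (v : ℚ) ∈ G) :
    ((v : ℚ) ∈ P ↔ (Odd (above G v) ↔ ¬u)) ∧ ((v : ℚ) - 1 ∈ P ↔ (Odd (above G v) ↔ u)) := by
  have h1 := h.odd_above hg.1 hvm.le
  have h2 := h.natCast_lt_iff hg hn hv1 hvm
  obtain ⟨i, rfl⟩ : ∃ i, v = i + 1 := ⟨v - 1, by omega⟩
  have h3 := (h.mem_iff i).1 hv
  obtain ⟨he, hP, -⟩ := id h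
  have h4 : (i : ℚ) ∈ P → ((i + 1 : ℕ) : ℚ) ∉ P := fun hp => by simpa using hP _ hp
  have h5 : e ≠ ((i + 1 : ℕ) : ℚ) := by
    rcases he with rfl | rfl
    · norm_cast
      omega
    · norm_cast
      omega
  have h6 : ((i + 1 : ℕ) : ℚ) - 1 = i := by push_cast; ring
  rw [h6]
  tauto

theorem vfLowerFacet_iff {m d v : ℕ} {F : Finset ℚ} (hn : 2 * d + 1 < m) (hv1 : 1 < v)
    (hvm : v < m) (hvF : (v : ℚ) ∉ F) :
    VFLowerFacet m v (2 * d + 1) F ↔ ∃ u, Gale u (vSet m) (2 * d + 1) (insert (v : ℚ) F) ∧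
      (Odd (above (insert (v : ℚ) F) v) ↔ ¬u) := by
  have hv := Finset.mem_insert_self (v : ℚ) F
  rw [VFLowerFacet, isFacet_iff_exists_gale]
  constructor
  · rintro ⟨-, ⟨u, hu⟩, P, e, hd, hvP⟩
    exact ⟨u, hu, (hd.mem_start_iff hu hn hv1 hvm hv).1.1 hvP⟩
  · rintro ⟨u, hu, hodd⟩
    obtain ⟨P, e, hd⟩ := hu.exists_pairDecomp hn
    exact ⟨hvF, ⟨u, hu⟩, P, e, hd, (hd.mem_start_iff hu hn hv1 hvm hv).1.2 hodd⟩

theorem vfUpperFacet_iff {m d v : ℕ} {F : Finset ℚ} (hn : 2 * d + 1 < m) (hv1 : 1 < v)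
    (hvm : v < m) (hvF : (v : ℚ) ∉ F) :
    VFUpperFacet m v (2 * d + 1) F ↔ ∃ u, Gale u (vSet m) (2 * d + 1) (insert (v : ℚ) F) ∧
      (Odd (above (insert (v : ℚ) F) v) ↔ u) := by
  have hv := Finset.mem_insert_self (v : ℚ) F
  rw [VFUpperFacet, isFacet_iff_exists_gale]
  constructor
  · rintro ⟨-, ⟨u, hu⟩, P, e, hd, hvP⟩
    exact ⟨u, hu, (hd.mem_start_iff hu hn hv1 hvm hv).2.1 hvP⟩
  · rintro ⟨u, hu, hodd⟩
    obtain ⟨P, e, hd⟩ := hu.exists_pairDecomp hn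
    exact ⟨hvF, ⟨u, hu⟩, P, e, hd, (hd.mem_start_iff hu hn hv1 hvm hv).2.2 hodd⟩

theorem natCast_lt_iff_of_abs_sub_lt {i v : ℕ} {z : ℚ} (hz : |z - v| < 1) (hi : i ≠ v) :
    ((i : ℚ) < z ↔ i < v) ∧ (z < i ↔ v < i) := by
  rw [abs_lt] at hz
  rcases lt_or_gt_of_ne hi with h | h
  · have : (i : ℚ) + 1 ≤ v := by exact_mod_cast h
    exact ⟨iff_of_true (by linarith) h, iff_of_false (by linarith) (by omega)⟩
  · have : (v : ℚ) + 1 ≤ i := by exact_mod_cast h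
    exact ⟨iff_of_false (by linarith) (by omega), iff_of_true (by linarith) h⟩

/-- Replacing `v` by a vertex `z` near `v`, next to a gap `z'` near `v`, preserves Gale's
criterion up to the condition at the gap. -/
theorem gale_insert_iff {m n v : ℕ} {u : Prop} {F : Finset ℚ} {z z' : ℚ}
    (hF : F ⊆ (vSet m).erase (v : ℚ)) (hv1 : 1 < v) (hvm : v < m)
    (hz : |z - v| < 1) (hzv : z ≠ v) (hz' : |z' - v| < 1) (hzv' : z' ≠ v) (hzz' : z' ≠ z) :
    Gale u (insert z (insert z' ((vSet m).erase (v : ℚ)))) n (insert z F) ↔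
      Gale u (vSet m) n (insert (v : ℚ) F) ∧
        (Odd (above (insert (v : ℚ) F) v + if z' < z then 1 else 0) ↔ u) := by
  have notMem : ∀ {t : ℚ}, |t - v| < 1 → t ∉ F := by
    intro t ht htF
    obtain ⟨hne, hmem⟩ := Finset.mem_erase.1 (hF htF)
    obtain ⟨i, -, -, rfl⟩ := mem_vSet.1 hmem
    have h := natCast_lt_iff_of_abs_sub_lt ht (by exact_mod_cast hne)
    simp only [lt_irrefl, false_iff] at h
    exact hne (by rw [show i = v by omega])
  have hvF : (v : ℚ) ∉ F := notMem (by simp)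
  have hzF := notMem hz
  have hzF' := notMem hz'
  have hcard : (insert z F).card = (insert (v : ℚ) F).card := by
    rw [Finset.card_insert_of_notMem hzF, Finset.card_insert_of_notMem hvF]
  have hgap : ∀ w ∈ vSet m, w ≠ v → above (insert z F) w = above (insert (v : ℚ) F) w := by
    intro w hw hwv
    obtain ⟨i, -, -, rfl⟩ := mem_vSet.1 hw
    rw [above_insert hzF, above_insert hvF]
    simp only [(natCast_lt_iff_of_abs_sub_lt hz (by exact_mod_cast hwv)).1, Nat.cast_lt]
  have hgap' : above (insert z F) z' = above (insert (v : ℚ) F) v + if z' < z then 1 else 0 := by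
    rw [above_insert hzF, above_insert hvF, if_neg (lt_irrefl _), add_zero]
    congr 1
    refine above_congr fun x hx => ?_
    obtain ⟨hne, hmem⟩ := Finset.mem_erase.1 (hF hx)
    obtain ⟨i, -, -, rfl⟩ := mem_vSet.1 hmem
    rw [(natCast_lt_iff_of_abs_sub_lt hz' (by exact_mod_cast hne)).2, Nat.cast_lt]
  constructor
  · rintro ⟨-, hc, hg⟩
    refine ⟨⟨?_, hcard ▸ hc, fun w hw => ?_⟩, ?_⟩
    · exact Finset.insert_subset (natCast_mem_vSet.2 ⟨hv1.le, hvm.le⟩)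
        (hF.trans (Finset.erase_subset _ _))
    · simp only [Finset.mem_sdiff, Finset.mem_insert, not_or] at hw
      obtain ⟨hw, hwv, hwF⟩ := hw
      rw [← hgap w hw hwv]
      refine hg w ?_
      have hwz : w ≠ z := by
        rintro rfl
        obtain ⟨i, -, -, rfl⟩ := mem_vSet.1 hw
        have h := natCast_lt_iff_of_abs_sub_lt hz (by exact_mod_cast hwv)
        simp only [lt_irrefl, false_iff] at h
        exact hwv (by rw [show i = v by omega])
      simp [hw, hwv, hwF, hwz]
    · rw [← hgap']
      exact hg z' (by simp [hzz', hzF'])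
  · rintro ⟨⟨-, hc, hg⟩, hodd⟩
    refine ⟨?_, hcard.trans hc, fun w hw => ?_⟩
    · exact Finset.insert_subset_insert _ (hF.trans (Finset.subset_insert _ _))
    · simp only [Finset.mem_sdiff, Finset.mem_insert, not_or, Finset.mem_erase] at hw
      obtain ⟨rfl | rfl | ⟨hwv, hw⟩, hwz, hwF⟩ := hw
      · exact absurd rfl hwz
      · rwa [hgap']
      · rw [hgap w hw hwv]
        exact hg w (by simp [hw, hwv, hwF])

/-- **Lemma.** `F` is a lower (resp. upper) facet of the vertex figure `C(m, 2d+1) ∖ v`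
if and only if `F ∪ {y}` (resp. `F ∪ {x}`) is a facet of `C([m]_{v+}, 2d + 1)`. -/
theorem vf_facets_under_expansion (d m v : ℕ) (hd : 1 ≤ d) (hm : 2 * d + 3 ≤ m)
    (hv1 : 1 < v) (hvm : v < m)
    (F : Finset ℚ) (hF : F ⊆ (vSet m).erase (v : ℚ)) (hcard : F.card = 2 * d) :
    (VFLowerFacet m (v : ℚ) (2 * d + 1) F ↔
      IsFacet (vPlus m v) (2 * d + 1) (insert (yOf v) F)) ∧
    (VFUpperFacet m (v : ℚ) (2 * d + 1) F ↔
      IsFacet (vPlus m v) (2 * d + 1) (insert (xOf v) F)) := by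
  have hvF : (v : ℚ) ∉ F := fun h => (Finset.mem_erase.1 (hF h)).1 rfl
  have hx : |xOf v - v| < 1 := by rw [xOf, abs_lt]; constructor <;> linarith
  have hy : |yOf v - v| < 1 := by rw [yOf, abs_lt]; constructor <;> linarith
  have hxv : xOf v ≠ v := by rw [xOf]; intro h; linarith
  have hyv : yOf v ≠ v := by rw [yOf]; intro h; linarith
  have hxy : xOf v < yOf v := by rw [xOf, yOf]; linarith
  rw [vfLowerFacet_iff (by omega) hv1 hvm hvF, vfUpperFacet_iff (by omega) hv1 hvm hvF,
    isFacet_iff_exists_gale, isFacet_iff_exists_gale]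
  constructor <;> refine exists_congr fun u => ?_
  · rw [vPlus, Finset.insert_comm, gale_insert_iff hF hv1 hvm hy hyv hx hxv hxy.ne, if_pos hxy,
      Nat.odd_add_one]
    tauto
  · rw [vPlus, gale_insert_iff hF hv1 hvm hx hxv hy hyv hxy.ne', if_neg hxy.not_gt, add_zero]

end HST
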